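/- Under the smoothness and convexity assumptions, let 0 < μ⁺ ≤ μ ≤ 1/2 with μ ≤ 2μ⁺, let the step size satisfy 0 < β ≤ 2/(σ_{ψμ} + L_{ψμ}), and let x, y be arbitrary with y⁺ := y − β∇_y ψ_μ(x,y) and x⁺ ∈ ℝⁿ arbitrary. Then ‖y⁺ − y*_{μ⁺}(x⁺)‖² − ‖y − y*_μ(x)‖² ≤ −(1/2) β σ_{ψμ} ‖y − y*_μ(x)‖² + (6L_{ψy1}²/(β σ_{ψμ}³)) ‖x − x⁺‖² + (24‖∇_y F(x⁺, y*_{μ⁺}(x⁺))‖²/(σ_F² β σ_{ψμ})) ((μ − μ⁺)/μ)². -/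

import Mathlib

open Set Filter Asymptotics
open scoped NNReal

noncomputable section

/-- `ℝⁿ` as a Euclidean space. -/
abbrev Eu (n : ℕ) : Type := EuclideanSpace ℝ (Fin n)

variable {n m : ℕ}

/-- Partial gradient with respect to the first (upper-level) variable. -/
def gradx (F : Eu n → Eu m → ℝ) (x : Eu n) (y : Eu m) : Eu n :=
  gradient (fun x' => F x' y) x

/-- Partial gradient with respect to the second (lower-level) variable. -/
def grady (F : Eu n → Eu m → ℝ) (x : Eu n) (y : Eu m) : Eu m :=
  gradient (fun y' => F x y') y

/-- Second-order partial derivative `∇²_{yy}`. -/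
def hessyy (F : Eu n → Eu m → ℝ) (x : Eu n) (y : Eu m) : Eu m →L[ℝ] Eu m :=
  fderiv ℝ (fun y' => grady F x y') y

/-- Mixed second-order partial derivative `∇²_{xy}`, viewed as the linear map
sending a multiplier `v ∈ ℝᵐ` to an element of `ℝⁿ`. -/
def hessxy (F : Eu n → Eu m → ℝ) (x : Eu n) (y : Eu m) : Eu m →L[ℝ] Eu n :=
  ContinuousLinearMap.adjoint (fderiv ℝ (fun x' => grady F x' y) x)

/-- The aggregation function `ψ_μ = μ F + (1-μ) f`. -/
def aggreg (μ : ℝ) (F f : Eu n → Eu m → ℝ) : Eu n → Eu m → ℝ :=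
  fun x y => μ * F x y + (1 - μ) * f x y

/-- The squared KKT residual of the equality-constrained reformulation
`min F(x,y) s.t. ∇_y f(x,y) = 0`. -/
def KKTres (F f : Eu n → Eu m → ℝ) (x : Eu n) (y v : Eu m) : ℝ :=
  ‖gradx F x y - hessxy f x y v‖ ^ 2 + ‖grady F x y - hessyy f x y v‖ ^ 2 +
    ‖grady f x y‖ ^ 2

open scoped RealInnerProductSpace

section GradientInequalities

variable {E : Type*} [NormedAddCommGroup E] [InnerProductSpace ℝ E] [CompleteSpace E]

/-- The derivative of a function along a line is the inner product of the gradient with the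
direction. -/
lemma HasGradientAt.hasDerivAt_line {φ : E → ℝ} {g p v : E} {t : ℝ}
    (h : HasGradientAt φ g (p + t • v)) :
    HasDerivAt (fun s : ℝ => φ (p + s • v)) ⟪g, v⟫ t := by
  have hline : HasDerivAt (fun s : ℝ => p + s • v) v t := by
    simpa using ((hasDerivAt_id t).smul_const v).const_add p
  simpa [Function.comp_def] using h.hasFDerivAt.comp_hasDerivAt t hline

/-- First-order lower bound for a convex function. -/
lemma ConvexOn.add_inner_gradient_le {φ : E → ℝ} (hφ : ConvexOn ℝ univ φ) {g p : E}
    (hg : HasGradientAt φ g p) (z : E) : φ p + ⟪g, z - p⟫ ≤ φ z := by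
  have hconv : ConvexOn ℝ univ (φ ∘ AffineMap.lineMap (k := ℝ) p z) := by
    simpa using hφ.comp_affineMap (AffineMap.lineMap (k := ℝ) p z)
  have hd : HasDerivAt (φ ∘ AffineMap.lineMap (k := ℝ) p z) ⟪g, z - p⟫ 0 := by
    have h0 : HasGradientAt φ g (p + (0 : ℝ) • (z - p)) := by simpa using hg
    refine h0.hasDerivAt_line.congr_of_eventuallyEq (Eventually.of_forall fun s => ?_)
    simp [AffineMap.lineMap_apply, add_comm]
  have h := hconv.le_slope_of_hasDerivAt (mem_univ 0) (mem_univ 1) one_pos hd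
  simp only [slope_def_field, Function.comp_apply, AffineMap.lineMap_apply_one,
    AffineMap.lineMap_apply_zero, sub_zero, div_one] at h
  linarith

/-- The gradient of a convex function is monotone. -/
lemma ConvexOn.inner_gradient_sub_nonneg {φ : E → ℝ} (hφ : ConvexOn ℝ univ φ) {g g' p q : E}
    (hp : HasGradientAt φ g p) (hq : HasGradientAt φ g' q) : 0 ≤ ⟪g - g', p - q⟫ := by
  have h1 := hφ.add_inner_gradient_le hp q
  have h2 := hφ.add_inner_gradient_le hq p
  simp only [inner_sub_left, inner_sub_right] at *
  linarith

/-- Quadratic upper bound for a function whose gradient satisfies a one-sided Lipschitz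
condition. -/
lemma le_add_inner_gradient_add_sq {φ : E → ℝ} {g : E → E} {M : ℝ}
    (hg : ∀ p, HasGradientAt φ (g p) p)
    (hM : ∀ p q, ⟪g p - g q, p - q⟫ ≤ M * ‖p - q‖ ^ 2) (p v : E) :
    φ (p + v) ≤ φ p + ⟪g p, v⟫ + M / 2 * ‖v‖ ^ 2 := by
  let h : ℝ → ℝ := fun t => φ (p + t • v) - t * ⟪g p, v⟫ - M / 2 * ‖v‖ ^ 2 * t ^ 2
  have hd (t : ℝ) : HasDerivAt h (⟪g (p + t • v), v⟫ - ⟪g p, v⟫ - M * ‖v‖ ^ 2 * t) t := by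
    have := (((hg (p + t • v)).hasDerivAt_line).sub
      ((hasDerivAt_id t).mul_const ⟪g p, v⟫)).sub
        (((hasDerivAt_id t).pow 2).const_mul (M / 2 * ‖v‖ ^ 2))
    refine this.congr_deriv ?_
    simp
    ring
  have hanti : AntitoneOn h (Ici 0) := by
    refine antitoneOn_of_deriv_nonpos (convex_Ici 0)
      (fun t _ => (hd t).continuousAt.continuousWithinAt)
      (fun t _ => (hd t).differentiableAt.differentiableWithinAt) fun t ht => ?_
    rw [interior_Ici, mem_Ioi] at ht
    rw [(hd t).deriv]
    have := hM (p + t • v) p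
    simp only [add_sub_cancel_left, inner_smul_right, norm_smul, Real.norm_eq_abs, mul_pow,
      sq_abs, inner_sub_left] at this
    have h2 : t * (⟪g (p + t • v), v⟫ - ⟪g p, v⟫ - M * ‖v‖ ^ 2 * t) ≤ 0 := by linarith
    exact nonpos_of_mul_nonpos_right h2 ht
  have := hanti (mem_Ici.2 le_rfl) (mem_Ici.2 zero_le_one) zero_le_one
  simp only [h, one_smul, zero_smul, add_zero] at this
  linarith

/-- Cocoercivity of the gradient of a convex function. -/
lemma ConvexOn.norm_sq_gradient_sub_le {φ : E → ℝ} {g : E → E} {M : ℝ}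
    (hφ : ConvexOn ℝ univ φ) (hg : ∀ p, HasGradientAt φ (g p) p) (hM0 : 0 ≤ M)
    (hM : ∀ p q, ⟪g p - g q, p - q⟫ ≤ M * ‖p - q‖ ^ 2) (p q : E) :
    ‖g p - g q‖ ^ 2 ≤ M * ⟪g p - g q, p - q⟫ := by
  have half (s : ℝ) (p q : E) : φ q + ⟪g q, p - q⟫ + s * ‖g p - g q‖ ^ 2
      - M / 2 * s ^ 2 * ‖g p - g q‖ ^ 2 ≤ φ p := by
    have h1 := le_add_inner_gradient_add_sq hg hM p (-s • (g p - g q))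
    have h2 := hφ.add_inner_gradient_le (hg q) (p + -s • (g p - g q))
    have e : p + -s • (g p - g q) - q = (p - q) + -s • (g p - g q) := by abel
    rw [e, inner_add_right] at h2
    have h3 : ⟪g p, g p - g q⟫ - ⟪g q, g p - g q⟫ = ‖g p - g q‖ ^ 2 := by
      rw [← inner_sub_left, real_inner_self_eq_norm_sq]
    simp only [inner_smul_right, norm_smul, norm_neg, Real.norm_eq_abs, mul_pow, sq_abs] at h1 h2
    rw [← h3] at h1 ⊢
    linarith
  have key (s : ℝ) : 2 * s * ‖g p - g q‖ ^ 2 - M * s ^ 2 * ‖g p - g q‖ ^ 2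
      ≤ ⟪g p - g q, p - q⟫ := by
    have h1 := half s p q
    have h2 := half s q p
    rw [norm_sub_rev (g q)] at h2
    simp only [inner_sub_left, inner_sub_right] at *
    linarith
  rcases hM0.eq_or_lt with rfl | hpos
  · by_contra! hlt
    have hN : 0 < ‖g p - g q‖ ^ 2 := by linarith
    have h := key ((⟪g p - g q, p - q⟫ + 1) / (2 * ‖g p - g q‖ ^ 2))
    have hN' := hN.ne'
    have e : 2 * ((⟪g p - g q, p - q⟫ + 1) / (2 * ‖g p - g q‖ ^ 2)) * ‖g p - g q‖ ^ 2
        = ⟪g p - g q, p - q⟫ + 1 := by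
      generalize ‖g p - g q‖ ^ 2 = N at hN'
      field_simp
    linarith
  · have := mul_le_mul_of_nonneg_left (key M⁻¹) hpos.le
    field_simp at this
    linarith

/-- Subtracting `σ / 2 * ‖x‖ ^ 2` from a function subtracts `σ • x` from its gradient. -/
lemma HasGradientAt.sub_half_mul_norm_sq {ψ : E → ℝ} {g p : E} (h : HasGradientAt ψ g p)
    (σ : ℝ) : HasGradientAt (fun x => ψ x - σ / 2 * ‖x‖ ^ 2) (g - σ • p) p := by
  rw [hasGradientAt_iff_hasFDerivAt] at *
  refine (h.sub ((hasStrictFDerivAt_norm_sq p).hasFDerivAt.const_mul (σ / 2))).congr_fderiv ?_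
  ext v
  simp
  ring

/-- The gradient of a strongly convex function is strongly monotone. -/
lemma StrongConvexOn.mul_norm_sq_le_inner_gradient_sub {ψ : E → ℝ} {σ : ℝ}
    (hψ : StrongConvexOn univ σ ψ) {g g' p q : E}
    (hp : HasGradientAt ψ g p) (hq : HasGradientAt ψ g' q) :
    σ * ‖p - q‖ ^ 2 ≤ ⟪g - g', p - q⟫ := by
  have h := (strongConvexOn_iff_convex.1 hψ).inner_gradient_sub_nonneg
    (hp.sub_half_mul_norm_sq σ) (hq.sub_half_mul_norm_sq σ)
  have e : g - σ • p - (g' - σ • q) = (g - g') - σ • (p - q) := by module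
  rw [e, inner_sub_left, real_inner_smul_left, real_inner_self_eq_norm_sq] at h
  linarith

/-- One step of gradient descent on a strongly convex function contracts the distance to the
critical point. -/
lemma StrongConvexOn.norm_sq_gradient_step_le {ψ : E → ℝ} {g : E → E} {σ L β : ℝ}
    (hψ : StrongConvexOn univ σ ψ) (hg : ∀ p, HasGradientAt ψ (g p) p) (hσ : 0 < σ)
    (hσL : σ ≤ L) (hL : ∀ p q, ‖g p - g q‖ ≤ L * ‖p - q‖) (hβ0 : 0 < β)
    (hβ : β ≤ 2 / (σ + L)) {a : E} (ha : g a = 0) (y : E) :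
    ‖y - β • g y - a‖ ^ 2 ≤ (1 - β * σ) * ‖y - a‖ ^ 2 := by
  have hβ' : β * (σ + L) ≤ 2 := (le_div_iff₀ (by linarith)).1 hβ
  have hβσ : β * σ ≤ 1 := by nlinarith
  have hsub (p q : E) : g p - σ • p - (g q - σ • q) = (g p - g q) - σ • (p - q) := by module
  have hcoco := (strongConvexOn_iff_convex.1 hψ).norm_sq_gradient_sub_le
    (g := fun p => g p - σ • p) (M := L - σ) (fun p => (hg p).sub_half_mul_norm_sq σ)
    (sub_nonneg.2 hσL) (fun p q => by
      have h := (real_inner_le_norm (g p - g q) (p - q)).trans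
        (mul_le_mul_of_nonneg_right (hL p q) (norm_nonneg _))
      rw [hsub, inner_sub_left, real_inner_smul_left, real_inner_self_eq_norm_sq]
      linarith) y a
  have hmono := hψ.mul_norm_sq_le_inner_gradient_sub (hg y) (hg a)
  simp only [hsub] at hcoco
  rw [ha, sub_zero] at hcoco hmono
  have e : y - β • g y - a = (y - a) - β • g y := by abel
  rw [norm_sub_sq_real, inner_sub_left, inner_smul_right, real_inner_smul_left, norm_smul,
    real_inner_self_eq_norm_sq, mul_pow, Real.norm_eq_abs, sq_abs] at hcoco
  rw [e, norm_sub_sq_real, inner_smul_right, norm_smul, mul_pow, Real.norm_eq_abs, sq_abs,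
    real_inner_comm]
  set c := ⟪g y, y - a⟫
  set G := ‖g y‖ ^ 2
  set e2 := ‖y - a‖ ^ 2
  have he2 : 0 ≤ e2 := sq_nonneg _
  have h1 : β * (G - 2 * (σ * c) + σ ^ 2 * e2) ≤ 2 * (1 - β * σ) * (c - σ * e2) :=
    calc _ ≤ β * ((L - σ) * (c - σ * e2)) := mul_le_mul_of_nonneg_left hcoco hβ0.le
      _ = (β * (L - σ)) * (c - σ * e2) := by ring
      _ ≤ _ := mul_le_mul_of_nonneg_right (by linarith) (by linarith)
  have h2 : 0 ≤ σ * e2 * (1 - β * σ) := mul_nonneg (by positivity) (by linarith)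
  have h3 : β * G + σ * e2 ≤ 2 * c := by linarith
  nlinarith

/-- A strongly convex function with an `L`-Lipschitz gradient on a nontrivial space has modulus
at most `L`. -/
lemma StrongConvexOn.modulus_le_of_gradient_lipschitz [Nontrivial E] {ψ : E → ℝ} {g : E → E}
    {σ L : ℝ} (hψ : StrongConvexOn univ σ ψ) (hg : ∀ p, HasGradientAt ψ (g p) p)
    (hL : ∀ p q, ‖g p - g q‖ ≤ L * ‖p - q‖) : σ ≤ L := by
  obtain ⟨p, hp⟩ := exists_ne (0 : E)
  have hpos : 0 < ‖p - 0‖ ^ 2 := by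
    rw [sub_zero]
    exact pow_pos (norm_pos_iff.2 hp) 2
  have h := (real_inner_le_norm (g p - g 0) (p - 0)).trans
    (mul_le_mul_of_nonneg_right (hL p 0) (norm_nonneg _))
  have := hψ.mul_norm_sq_le_inner_gradient_sub (hg p) (hg 0)
  exact le_of_mul_le_mul_right (by linarith) hpos

/-- At a critical point `a`, a strongly convex function satisfies an error bound in terms of the
gradient. -/
lemma StrongConvexOn.mul_norm_sub_le_norm_gradient {ψ : E → ℝ} {σ : ℝ} {a b g : E}
    (hψ : StrongConvexOn univ σ ψ) (ha : HasGradientAt ψ 0 a) (hb : HasGradientAt ψ g b) :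
    σ * ‖b - a‖ ≤ ‖g‖ := by
  rcases (norm_nonneg (b - a)).eq_or_lt with h0 | hpos
  · simp [← h0]
  · have h := hψ.mul_norm_sq_le_inner_gradient_sub hb ha
    rw [sub_zero] at h
    have h' := real_inner_le_norm g (b - a)
    exact le_of_mul_le_mul_right (by linarith) hpos

/-- A gradient vanishes at a global minimizer. -/
lemma HasGradientAt.eq_zero_of_forall_le {φ : E → ℝ} {g a : E} (hg : HasGradientAt φ g a)
    (ha : ∀ y, φ a ≤ φ y) : g = 0 := by
  have := (show IsLocalMin φ a from Eventually.of_forall ha).hasFDerivAt_eq_zero hg.hasFDerivAt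
  simpa using this

end GradientInequalities

/-- Weighted Young inequality for a squared distance. -/
lemma norm_sub_sq_le_weighted {E : Type*} [SeminormedAddCommGroup E] {t : ℝ} (ht : 0 < t) (u a b : E) :
    ‖u - b‖ ^ 2 ≤ (1 + t) * ‖u - a‖ ^ 2 + (1 + t⁻¹) * ‖b - a‖ ^ 2 := by
  have h : ‖u - b‖ ≤ ‖u - a‖ + ‖b - a‖ := by
    simpa [norm_sub_rev b a] using norm_sub_le_norm_sub_add_norm_sub u a b
  have h1 : ‖u - b‖ ^ 2 ≤ (‖u - a‖ + ‖b - a‖) ^ 2 := pow_le_pow_left₀ (norm_nonneg _) h 2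
  have h2 : 0 ≤ t⁻¹ * (t * ‖u - a‖ - ‖b - a‖) ^ 2 := by positivity
  have h3 : t⁻¹ * (t * ‖u - a‖ - ‖b - a‖) ^ 2
      = t * ‖u - a‖ ^ 2 - 2 * ‖u - a‖ * ‖b - a‖ + t⁻¹ * ‖b - a‖ ^ 2 := by
    field_simp
    ring
  linarith

section Aggregation

variable {F f : Eu n → Eu m → ℝ}

lemma hasGradientAt_grady (hF : ContDiff ℝ 2 (Function.uncurry F)) (x : Eu n) (y : Eu m) :
    HasGradientAt (F x) (grady F x y) y := by
  have h : DifferentiableAt ℝ (fun y' => Function.uncurry F (x, y')) y :=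
    ((hF.differentiable (by norm_num)).comp (by fun_prop : Differentiable ℝ fun y' => (x, y'))) y
  exact DifferentiableAt.hasGradientAt h

lemma hasGradientAt_aggreg (hF : ContDiff ℝ 2 (Function.uncurry F))
    (hf : ContDiff ℝ 2 (Function.uncurry f)) (μ : ℝ) (x : Eu n) (y : Eu m) :
    HasGradientAt (aggreg μ F f x) (μ • grady F x y + (1 - μ) • grady f x y) y := by
  have h1 := (hasGradientAt_grady hF x y).hasFDerivAt.const_mul μ
  have h2 := (hasGradientAt_grady hf x y).hasFDerivAt.const_mul (1 - μ)
  rw [hasGradientAt_iff_hasFDerivAt]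
  refine (h1.add h2).congr_fderiv ?_
  simp

lemma grady_aggreg (hF : ContDiff ℝ 2 (Function.uncurry F))
    (hf : ContDiff ℝ 2 (Function.uncurry f)) (μ : ℝ) (x : Eu n) (y : Eu m) :
    grady (aggreg μ F f) x y = μ • grady F x y + (1 - μ) • grady f x y :=
  (hasGradientAt_aggreg hF hf μ x y).gradient

lemma strongConvexOn_aggreg {μ σ : ℝ} (hμ0 : 0 ≤ μ) (hμ1 : μ ≤ 1) {x : Eu n}
    (hF : StrongConvexOn univ σ (F x)) (hf : ConvexOn ℝ univ (f x)) :
    StrongConvexOn univ (μ * σ) (aggreg μ F f x) := by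
  rw [strongConvexOn_iff_convex] at *
  refine ((hF.smul hμ0).add (hf.smul (sub_nonneg.2 hμ1))).congr fun y _ => ?_
  simp only [aggreg, Pi.add_apply, smul_eq_mul]
  ring

/-- Lipschitz bounds for two maps combine convexly. -/
lemma norm_convexCombination_sub_le {X E : Type*} [SeminormedAddCommGroup X]
    [SeminormedAddCommGroup E] [NormedSpace ℝ E] {u v : X → E} {K K' : ℝ≥0}
    (hu : LipschitzWith K u) (hv : LipschitzWith K' v) {μ : ℝ} (hμ0 : 0 ≤ μ) (hμ1 : μ ≤ 1)
    (p q : X) :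
    ‖(μ • u p + (1 - μ) • v p) - (μ • u q + (1 - μ) • v q)‖
      ≤ (μ * K + (1 - μ) * K') * ‖p - q‖ := by
  have e : (μ • u p + (1 - μ) • v p) - (μ • u q + (1 - μ) • v q)
      = μ • (u p - u q) + (1 - μ) • (v p - v q) := by module
  have h1 := mul_le_mul_of_nonneg_left (hu.norm_sub_le p q) hμ0
  have h2 := mul_le_mul_of_nonneg_left (hv.norm_sub_le p q) (sub_nonneg.2 hμ1)
  rw [e]
  refine (norm_add_le _ _).trans ?_
  rw [norm_smul_of_nonneg hμ0, norm_smul_of_nonneg (sub_nonneg.2 hμ1)]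
  linarith

/-- If the convex combination of two vectors with weight `ν` vanishes, then the combination with
weight `μ` is controlled by the difference of the weights. -/
lemma norm_combination_le_of_critical {E : Type*} [SeminormedAddCommGroup E] [NormedSpace ℝ E]
    {μ ν : ℝ} (hν : ν ≤ 1 / 2) (hle : ν ≤ μ) {u v : E}
    (h : ν • u + (1 - ν) • v = 0) :
    ‖μ • u + (1 - μ) • v‖ ≤ 2 * (μ - ν) * ‖u‖ := by
  have hpos : 0 < 1 - ν := by linarith
  have e : (1 - ν) • (μ • u + (1 - μ) • v) = (μ - ν) • u := by
    calc (1 - ν) • (μ • u + (1 - μ) • v)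
        = (1 - μ) • (ν • u + (1 - ν) • v) + (μ - ν) • u := by module
      _ = (μ - ν) • u := by rw [h, smul_zero, zero_add]
  have e' := congrArg norm e
  rw [norm_smul_of_nonneg hpos.le, norm_smul_of_nonneg (sub_nonneg.2 hle)] at e'
  nlinarith [norm_nonneg (μ • u + (1 - μ) • v)]

/-- Sensitivity of the minimizer of the aggregation function in the variable `x` and the
weight. -/
lemma mul_norm_minimizer_sub_le (hF : ContDiff ℝ 2 (Function.uncurry F))
    (hf : ContDiff ℝ 2 (Function.uncurry f)) {KF Kf : ℝ≥0}
    (hKF : ∀ y, LipschitzWith KF fun x => grady F x y)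
    (hKf : ∀ y, LipschitzWith Kf fun x => grady f x y) {σ μ ν : ℝ}
    (hFsc : ∀ x, StrongConvexOn univ σ (F x)) (hfconv : ∀ x, ConvexOn ℝ univ (f x))
    (hμ0 : 0 ≤ μ) (hμ1 : μ ≤ 1) (hν : ν ≤ 1 / 2) (hle : ν ≤ μ) {x x' : Eu n} {a b : Eu m}
    (ha : ∀ y, aggreg μ F f x a ≤ aggreg μ F f x y)
    (hb : ∀ y, aggreg ν F f x' b ≤ aggreg ν F f x' y) :
    μ * σ * ‖b - a‖
      ≤ (μ * KF + (1 - μ) * Kf) * ‖x - x'‖ + 2 * (μ - ν) * ‖grady F x' b‖ := by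
  have ha0 := hasGradientAt_aggreg hF hf μ x a
  rw [ha0.eq_zero_of_forall_le ha] at ha0
  have hb0 := (hasGradientAt_aggreg hF hf ν x' b).eq_zero_of_forall_le hb
  have h1 := (strongConvexOn_aggreg hμ0 hμ1 (hFsc x) (hfconv x)).mul_norm_sub_le_norm_gradient
    ha0 (hasGradientAt_aggreg hF hf μ x b)
  have h2 := norm_convexCombination_sub_le (hKF b) (hKf b) hμ0 hμ1 x x'
  have h3 := norm_combination_le_of_critical hν hle hb0
  have h4 := norm_le_norm_sub_add (μ • grady F x b + (1 - μ) • grady f x b)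
    (μ • grady F x' b + (1 - μ) • grady f x' b)
  linarith

end Aggregation

/-- Lemma 3.10 / D.6, `y`-error recursion. -/
theorem lower_level_error_recursion {n m : ℕ}
    (F f : Eu n → Eu m → ℝ)
    (hF : ContDiff ℝ 2 (Function.uncurry F))
    (hf : ContDiff ℝ 2 (Function.uncurry f))
    (LFy1 LFy2 Lfy1 Lfy2 : ℝ≥0)
    (hLFy1 : ∀ y, LipschitzWith LFy1 fun x => grady F x y)
    (hLFy2 : ∀ x, LipschitzWith LFy2 fun y => grady F x y)
    (hLfy1 : ∀ y, LipschitzWith Lfy1 fun x => grady f x y)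
    (hLfy2 : ∀ x, LipschitzWith Lfy2 fun y => grady f x y)
    (σF : ℝ) (hσF : 0 < σF)
    (hFsc : ∀ x, StrongConvexOn univ σF (F x))
    (hfconv : ∀ x, ConvexOn ℝ univ (f x))
    (ystar : ℝ → Eu n → Eu m)
    (hmin : ∀ μ' ∈ Ioc (0 : ℝ) 1, ∀ x y,
      aggreg μ' F f x (ystar μ' x) ≤ aggreg μ' F f x y)
    (μ μplus : ℝ) (hμplus : 0 < μplus) (hle : μplus ≤ μ) (hμhalf : μ ≤ 1 / 2)
    (hμ2 : μ ≤ 2 * μplus)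
    (σψ Lψ Lψy1 : ℝ)
    (hσψ : σψ = μ * σF)
    (hLψ : Lψ = μ * LFy2 + (1 - μ) * Lfy2)
    (hLψy1 : Lψy1 = μ * LFy1 + (1 - μ) * Lfy1)
    (β : ℝ) (hβpos : 0 < β) (hβ : β ≤ 2 / (σψ + Lψ)) :
    ∀ (x xp : Eu n) (y : Eu m), ∀ yp : Eu m,
      yp = y - β • grady (aggreg μ F f) x y →
      ‖yp - ystar μplus xp‖ ^ 2 - ‖y - ystar μ x‖ ^ 2 ≤
        -(1 / 2) * β * σψ * ‖y - ystar μ x‖ ^ 2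
        + (6 * Lψy1 ^ 2 / (β * σψ ^ 3)) * ‖x - xp‖ ^ 2
        + (24 * ‖grady F xp (ystar μplus xp)‖ ^ 2 / (σF ^ 2 * β * σψ)) *
            ((μ - μplus) / μ) ^ 2 := by
  intro x xp y yp hyp
  have hμ : 0 < μ := hμplus.trans_le hle
  have hμ1 : μ ≤ 1 := by linarith
  have hσ : 0 < σψ := hσψ ▸ mul_pos hμ hσF
  rcases subsingleton_or_nontrivial (Eu m) with hsub | hnon
  · rw [Subsingleton.elim (yp - ystar μplus xp) 0, Subsingleton.elim (y - ystar μ x) 0]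
    simp only [norm_zero, ne_eq, OfNat.ofNat_ne_zero, not_false_eq_true, zero_pow, sub_self,
      mul_zero, zero_add]
    positivity
  have hgrad (p : Eu m) := hasGradientAt_aggreg hF hf μ x p
  have hsc : StrongConvexOn univ σψ (aggreg μ F f x) :=
    hσψ ▸ strongConvexOn_aggreg hμ.le hμ1 (hFsc x) (hfconv x)
  have hLip (p q : Eu m) := hLψ ▸
    norm_convexCombination_sub_le (hLFy2 x) (hLfy2 x) hμ.le hμ1 p q
  have hσL : σψ ≤ Lψ := hsc.modulus_le_of_gradient_lipschitz hgrad hLip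
  have hβσ : β * σψ ≤ 1 := by
    have := (le_div_iff₀ (by linarith)).1 hβ
    nlinarith
  have hmin_a := hmin μ ⟨hμ, hμ1⟩ x
  have hmin_b := hmin μplus ⟨hμplus, hle.trans hμ1⟩ xp
  have hstep := hsc.norm_sq_gradient_step_le hgrad hσ hσL hLip hβpos hβ
    ((hgrad _).eq_zero_of_forall_le hmin_a) y
  rw [← grady_aggreg hF hf, ← hyp] at hstep
  have hsens := mul_norm_minimizer_sub_le hF hf hLFy1 hLfy1 hFsc hfconv hμ.le hμ1
    (hle.trans hμhalf) hle hmin_a hmin_b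
  rw [← hσψ, ← hLψy1] at hsens
  have hyoung := norm_sub_sq_le_weighted (t := β * σψ / 2) (by positivity) yp
    (ystar μ x) (ystar μplus xp)
  set a := ystar μ x
  set b := ystar μplus xp
  set G := ‖grady F xp b‖
  have hba : ‖b - a‖ ^ 2 ≤
      2 * (Lψy1 * ‖x - xp‖ / σψ) ^ 2 + 2 * (2 * (μ - μplus) * G / σψ) ^ 2 := by
    have h : ‖b - a‖ ≤ Lψy1 * ‖x - xp‖ / σψ + 2 * (μ - μplus) * G / σψ := by
      rw [← add_div, le_div_iff₀ hσ]
      linarith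
    refine (pow_le_pow_left₀ (norm_nonneg _) h 2).trans ?_
    linarith [sq_nonneg (Lψy1 * ‖x - xp‖ / σψ - 2 * (μ - μplus) * G / σψ)]
  have hfactor : 1 + (β * σψ / 2)⁻¹ ≤ 3 / (β * σψ) := by
    rw [inv_div, le_div_iff₀ (by positivity), add_mul, div_mul_cancel₀ _ (by positivity)]
    linarith
  have hcontr : (1 + β * σψ / 2) * ‖yp - a‖ ^ 2 ≤ (1 - β * σψ / 2) * ‖y - a‖ ^ 2 := by
    have h1 := mul_le_mul_of_nonneg_left hstep (by positivity : 0 ≤ 1 + β * σψ / 2)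
    have h2 : 0 ≤ (β * σψ) ^ 2 / 2 * ‖y - a‖ ^ 2 := by positivity
    linarith
  have hdrift : (1 + (β * σψ / 2)⁻¹) * ‖b - a‖ ^ 2 ≤ 3 / (β * σψ) *
      (2 * (Lψy1 * ‖x - xp‖ / σψ) ^ 2 + 2 * (2 * (μ - μplus) * G / σψ) ^ 2) :=
    mul_le_mul hfactor hba (sq_nonneg _) (by positivity)
  have heq : 3 / (β * σψ) *
      (2 * (Lψy1 * ‖x - xp‖ / σψ) ^ 2 + 2 * (2 * (μ - μplus) * G / σψ) ^ 2)
      = (6 * Lψy1 ^ 2 / (β * σψ ^ 3)) * ‖x - xp‖ ^ 2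
        + (24 * G ^ 2 / (σF ^ 2 * β * σψ)) * ((μ - μplus) / μ) ^ 2 := by
    rw [hσψ]
    field_simp
    ring
  linarith
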